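/- arXiv:2408.12992 — 3 statements merged into one kernel-verified Lean document; each statement's English description precedes it below -/
import Mathlib

section
/- Let Ω ⊆ ℝ² be open, let σ : Ω → ℝ be continuously differentiable with σ(x) > 0 for all x ∈ Ω, and set μ(x) = (1 − σ(x))/(1 + σ(x)). If f : Ω → ℂ is twice continuously differentiable and satisfies the Beltrami equation ∂̄f(x) = μ(x)·conj(∂f(x)) for all x ∈ Ω (with μ real-valued), then u = Re f satisfies the conductivity equation ∂₁(σ ∂₁u) + ∂₂(σ ∂₂u) = 0 on Ω. -/
open Complex

/-- Partial derivative of a complex-valued function on `ℝ × ℝ` in the direction `v`. -/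
noncomputable def pdC (v : ℝ × ℝ) (f : ℝ × ℝ → ℂ) (x : ℝ × ℝ) : ℂ :=
  fderiv ℝ f x v

/-- Partial derivative of a real-valued function on `ℝ × ℝ` in the direction `v`. -/
noncomputable def pdR (v : ℝ × ℝ) (f : ℝ × ℝ → ℝ) (x : ℝ × ℝ) : ℝ :=
  fderiv ℝ f x v

lemma fderiv_re_apply {f : ℝ × ℝ → ℂ} {y : ℝ × ℝ} (hf : DifferentiableAt ℝ f y) (v : ℝ × ℝ) :
    fderiv ℝ (fun z => (f z).re) y v = (fderiv ℝ f y v).re := by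
  have h := (reCLM.hasFDerivAt.comp y hf.hasFDerivAt).fderiv
  exact congrArg (fun L : ℝ × ℝ →L[ℝ] ℝ => L v) h

lemma fderiv_im_fderiv_apply {f : ℝ × ℝ → ℂ} {x : ℝ × ℝ}
    (hf : DifferentiableAt ℝ (fderiv ℝ f) x) (v w : ℝ × ℝ) :
    fderiv ℝ (fun y => (fderiv ℝ f y v).im) x w = (fderiv ℝ (fderiv ℝ f) x w v).im := by
  have h := (imCLM.hasFDerivAt.comp x
    (hf.hasFDerivAt.clm_apply (hasFDerivAt_const v x))).fderiv
  have h' := congrArg (fun L : ℝ × ℝ →L[ℝ] ℝ => L w) h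
  simpa [Function.comp_def] using h'

/-- The real Cauchy-Riemann-type system implied by the Beltrami equation with coefficient
`(1 - s) / (1 + s)`. -/
lemma im_eq_of_beltrami {s : ℝ} (hs : 0 < s) {a b : ℂ}
    (h : (1 / 2 : ℂ) * (a + I * b)
      = (((1 - s) / (1 + s) : ℝ) : ℂ) * (starRingEnd ℂ) ((1 / 2 : ℂ) * (a - I * b))) :
    s * a.re = b.im ∧ s * b.re = -a.im := by
  have hs' : (1 + s) ≠ 0 := by positivity
  have hd : (1 - s) / (1 + s) * (1 + s) = 1 - s := div_mul_cancel₀ _ hs'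
  generalize (1 - s) / (1 + s) = m at h hd
  have h2 : a + I * b = (m : ℂ) * (starRingEnd ℂ) (a - I * b) := by
    have h12 : (starRingEnd ℂ) (1 / 2 : ℂ) = 1 / 2 := by simp [Complex.ext_iff]
    rw [map_mul, h12] at h
    linear_combination 2 * h
  have hre := congrArg re h2
  have him := congrArg im h2
  simp at hre him
  constructor
  · linear_combination (1 + s) / 2 * hre + (a.re + b.im) / 2 * hd
  · linear_combination (1 + s) / 2 * him + (b.re - a.im) / 2 * hd

theorem re_of_beltrami_solution_solves_conductivity_eq
    (Ω : Set (ℝ × ℝ)) (hΩ : IsOpen Ω)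
    (σ : ℝ × ℝ → ℝ) (hσ : ContDiffOn ℝ 1 σ Ω) (hσpos : ∀ x ∈ Ω, 0 < σ x)
    (μ : ℝ × ℝ → ℝ) (hμ : ∀ x, μ x = (1 - σ x) / (1 + σ x))
    (f : ℝ × ℝ → ℂ) (hf : ContDiffOn ℝ 2 f Ω)
    (hBeltrami : ∀ x ∈ Ω,
      (1 / 2 : ℂ) * (pdC (1, 0) f x + I * pdC (0, 1) f x)
        = (μ x : ℂ) * (starRingEnd ℂ) ((1 / 2 : ℂ) * (pdC (1, 0) f x - I * pdC (0, 1) f x)))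
    (u : ℝ × ℝ → ℝ) (hu : ∀ x, u x = (f x).re) :
    ∀ x ∈ Ω,
      pdR (1, 0) (fun y => σ y * pdR (1, 0) u y) x
        + pdR (0, 1) (fun y => σ y * pdR (0, 1) u y) x = 0 := by
  intro x hx
  have hnhds : ∀ᶠ y in nhds x, y ∈ Ω := hΩ.mem_nhds hx
  have hfx : ContDiffAt ℝ 2 f x := hf.contDiffAt hnhds
  have hsys : ∀ y ∈ Ω, σ y * pdR (1, 0) u y = (fderiv ℝ f y (0, 1)).im ∧
      σ y * pdR (0, 1) u y = -(fderiv ℝ f y (1, 0)).im := by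
    intro y hy
    have hfy : DifferentiableAt ℝ f y :=
      (hf.contDiffAt (hΩ.mem_nhds hy)).differentiableAt (by norm_num)
    have hB := hBeltrami y hy
    rw [hμ] at hB
    rw [funext hu, pdR, pdR, fderiv_re_apply hfy, fderiv_re_apply hfy]
    exact im_eq_of_beltrami (hσpos y hy) hB
  have h₁ : (fun y => σ y * pdR (1, 0) u y) =ᶠ[nhds x] fun y => (fderiv ℝ f y (0, 1)).im :=
    hnhds.mono fun y hy => (hsys y hy).1
  have h₂ : (fun y => σ y * pdR (0, 1) u y) =ᶠ[nhds x] fun y => -(fderiv ℝ f y (1, 0)).im :=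
    hnhds.mono fun y hy => (hsys y hy).2
  have hd : DifferentiableAt ℝ (fderiv ℝ f) x :=
    (hfx.fderiv_right (m := 1) (by norm_num)).differentiableAt (by norm_num)
  have hsymm : fderiv ℝ (fderiv ℝ f) x (1, 0) (0, 1) = fderiv ℝ (fderiv ℝ f) x (0, 1) (1, 0) :=
    (hfx.isSymmSndFDerivAt (by simp)).eq _ _
  rw [pdR, pdR, h₁.fderiv_eq, h₂.fderiv_eq, fderiv_fun_neg, neg_apply,
    fderiv_im_fderiv_apply hd, fderiv_im_fderiv_apply hd, hsymm, add_neg_cancel]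
end

section
/- Let μ : ℂ → ℂ be bounded and measurable with μ(x′) = 0 for |x′| ≥ 1, let φ ∈ ℝ, and for τ ∈ ℝ define the single-scattering term v₁(x, τ) = (−iτ e^{−iφ}/π) ∫_{|x′|<1} e^{−2iτ Re(e^{iφ}x′)} (x − x′)^{−1} μ(x′) dm(x′), where dm is Lebesgue measure on ℂ ≅ ℝ². Let ψ : ℝ → ℂ be a Schwartz function and set ψ̂(t) = ∫_ℝ e^{−itτ} ψ(τ) dτ. Then for every x ∈ ℂ all integrals below converge absolutely and ∫_ℝ ψ(τ) v₁(x, τ) dτ = (e^{−iφ}/π) ∫_{|x′|<1} ψ̂′(2 Re(e^{iφ}x′)) (x − x′)^{−1} μ(x′) dm(x′), where ψ̂′ denotes the derivative of ψ̂. -/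
open Complex MeasureTheory

/-- The Cauchy kernel is integrable on balls around its singularity. -/
lemma integrableOn_inv_ball_zero (r : ℝ) :
    IntegrableOn (fun z : ℂ => z⁻¹) (Metric.ball (0 : ℂ) r) := by
  have h : IntegrableOn (fun z : ℂ => ‖z‖⁻¹) (Metric.ball (0 : ℂ) r) := by
    rw [integrableOn_fun_norm_addHaar volume (f := fun y : ℝ => y⁻¹)]
    refine IntegrableOn.congr_fun (f := fun _ : ℝ => (1 : ℝ)) (by simp) ?_ measurableSet_Ioo
    intro y hy
    have : y ≠ 0 := hy.1.ne'
    simp [Complex.finrank_real_complex, this]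
  exact h.mono' measurable_inv.aestronglyMeasurable (by simp)

lemma integrableOn_inv_sub_ball_zero (x : ℂ) (r : ℝ) :
    IntegrableOn (fun z : ℂ => (x - z)⁻¹) (Metric.ball (0 : ℂ) r) := by
  have h := (Measure.measurePreserving_sub_left (volume : Measure ℂ) x).integrableOn_comp_preimage
    (MeasurableEquiv.subLeft x).measurableEmbedding (f := fun z : ℂ => z⁻¹)
    (s := Metric.ball (0 : ℂ) (‖x‖ + r))
  refine (h.2 (integrableOn_inv_ball_zero _)).mono_set fun z hz => ?_
  rw [Metric.mem_ball, dist_zero_right] at hz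
  rw [Set.mem_preimage, Metric.mem_ball, dist_zero_right]
  exact (norm_sub_le x z).trans_lt (by linarith)

lemma SchwartzMap.integrable_neg_I_mul_ofReal_mul (ψ : SchwartzMap ℝ ℂ) :
    Integrable (fun τ : ℝ => -(I * (τ : ℂ)) * ψ τ) := by
  refine (ψ.integrable_pow_mul volume 1).mono'
    (Continuous.aestronglyMeasurable (by have := ψ.continuous; fun_prop)) (.of_forall fun τ => ?_)
  simp

lemma norm_exp_neg_I_mul_ofReal_mul (t τ : ℝ) :
    ‖Complex.exp (-(I * (t : ℂ) * (τ : ℂ)))‖ = 1 := by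
  rw [show -(I * (t : ℂ) * (τ : ℂ)) = ((-(t * τ) : ℝ) : ℂ) * I by push_cast; ring]
  exact norm_exp_ofReal_mul_I _

/-- Differentiation under the integral sign for the Fourier transform of a Schwartz function. -/
lemma SchwartzMap.hasDerivAt_integral_exp_neg_I_mul (ψ : SchwartzMap ℝ ℂ) (t : ℝ) :
    HasDerivAt (fun t : ℝ => ∫ τ : ℝ, Complex.exp (-(I * (t : ℂ) * (τ : ℂ))) * ψ τ)
      (∫ τ : ℝ, Complex.exp (-(I * (t : ℂ) * (τ : ℂ))) * (-(I * (τ : ℂ)) * ψ τ)) t := by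
  have hc := ψ.continuous
  refine (hasDerivAt_integral_of_dominated_loc_of_deriv_le (s := Set.univ)
    (F := fun (t : ℝ) (τ : ℝ) => Complex.exp (-(I * (t : ℂ) * (τ : ℂ))) * ψ τ)
    (F' := fun (t : ℝ) (τ : ℝ) =>
      Complex.exp (-(I * (t : ℂ) * (τ : ℂ))) * (-(I * (τ : ℂ)) * ψ τ))
    (bound := fun τ : ℝ => ‖-(I * (τ : ℂ)) * ψ τ‖) Filter.univ_mem
    (.of_forall fun t => Continuous.aestronglyMeasurable (by fun_prop)) ?_
    (Continuous.aestronglyMeasurable (by fun_prop)) ?_ ψ.integrable_neg_I_mul_ofReal_mul.norm ?_).2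
  · exact ψ.integrable.bdd_mul (c := 1) (Continuous.aestronglyMeasurable (by fun_prop))
      (.of_forall fun τ => (norm_exp_neg_I_mul_ofReal_mul t τ).le)
  · refine .of_forall fun τ t _ => ?_
    rw [norm_mul, norm_exp_neg_I_mul_ofReal_mul, one_mul]
  · refine .of_forall fun τ t _ => ?_
    have h1 : HasDerivAt (fun t : ℝ => -(I * (t : ℂ) * (τ : ℂ))) (-(I * 1 * (τ : ℂ))) t :=
      ((((hasDerivAt_id (t : ℂ)).comp_ofReal).const_mul I).mul_const (τ : ℂ)).neg
    refine (h1.cexp.mul_const (ψ τ)).congr_deriv ?_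
    ring

theorem windowed_single_scattering_term_identity
    (μ : ℂ → ℂ) (hμmeas : Measurable μ) (hμbdd : ∃ C : ℝ, ∀ z : ℂ, ‖μ z‖ ≤ C)
    (hμsupp : ∀ z : ℂ, 1 ≤ ‖z‖ → μ z = 0)
    (φ : ℝ) (ψ : SchwartzMap ℝ ℂ)
    (ψhat : ℝ → ℂ)
    (hψhat : ∀ t : ℝ, ψhat t = ∫ τ : ℝ, Complex.exp (-(I * (t : ℂ) * (τ : ℂ))) * ψ τ)
    (v₁ : ℂ → ℝ → ℂ)
    (hv₁ : ∀ (x : ℂ) (τ : ℝ), v₁ x τ =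
      (-(I * (τ : ℂ) * Complex.exp (-(I * (φ : ℂ)))) / (Real.pi : ℂ)) *
        ∫ x' in Metric.ball (0 : ℂ) 1,
          Complex.exp (-(2 * I * (τ : ℂ) * (((Complex.exp (I * (φ : ℂ)) * x').re : ℝ) : ℂ)))
            * (x - x')⁻¹ * μ x') :
    ∀ x : ℂ,
      (∀ τ : ℝ, IntegrableOn (fun x' : ℂ =>
          Complex.exp (-(2 * I * (τ : ℂ) * (((Complex.exp (I * (φ : ℂ)) * x').re : ℝ) : ℂ)))
            * (x - x')⁻¹ * μ x')
          (Metric.ball (0 : ℂ) 1)) ∧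
      Integrable (fun τ : ℝ => ψ τ * v₁ x τ) ∧
      IntegrableOn (fun x' : ℂ =>
          deriv ψhat (2 * (Complex.exp (I * (φ : ℂ)) * x').re) * (x - x')⁻¹ * μ x')
          (Metric.ball (0 : ℂ) 1) ∧
      (∫ τ : ℝ, ψ τ * v₁ x τ)
        = (Complex.exp (-(I * (φ : ℂ))) / (Real.pi : ℂ)) *
          ∫ x' in Metric.ball (0 : ℂ) 1,
            deriv ψhat (2 * (Complex.exp (I * (φ : ℂ)) * x').re) * (x - x')⁻¹ * μ x' := by
  intro x
  obtain ⟨C, hC⟩ := hμbdd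
  have hg : IntegrableOn (fun x' : ℂ => (x - x')⁻¹ * μ x') (Metric.ball (0 : ℂ) 1) :=
    (integrableOn_inv_sub_ball_zero x 1).mul_bdd hμmeas.aestronglyMeasurable (.of_forall hC)
  set r : ℂ → ℝ := fun x' => (Complex.exp (I * (φ : ℂ)) * x').re
  have hrc : Continuous r := by fun_prop
  have hphase (τ : ℝ) (x' : ℂ) : Complex.exp (-(2 * I * (τ : ℂ) * (r x' : ℂ))) =
      Complex.exp (-(I * ((2 * r x' : ℝ) : ℂ) * (τ : ℂ))) := by
    congr 1; push_cast; ring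
  have hnorm (τ : ℝ) (x' : ℂ) : ‖Complex.exp (-(2 * I * (τ : ℂ) * (r x' : ℂ)))‖ ≤ 1 := by
    rw [hphase, norm_exp_neg_I_mul_ofReal_mul]
  set F : ℝ → ℂ → ℂ := fun τ x' => Complex.exp (-(2 * I * (τ : ℂ) * (r x' : ℂ))) *
    ((-(I * (τ : ℂ)) * ψ τ) * ((x - x')⁻¹ * μ x')) with hF
  have hFint : Integrable (Function.uncurry F)
      (volume.prod (volume.restrict (Metric.ball (0 : ℂ) 1))) :=
    (ψ.integrable_neg_I_mul_ofReal_mul.mul_prod hg).bdd_mul (c := 1)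
      (Continuous.aestronglyMeasurable (by fun_prop)) (.of_forall fun p => hnorm p.1 p.2)
  have hleft (τ : ℝ) : ψ τ * v₁ x τ = (Complex.exp (-(I * (φ : ℂ))) / (Real.pi : ℂ)) *
      ∫ x' in Metric.ball (0 : ℂ) 1, F τ x' := by
    have : ∀ x', F τ x' = (-(I * (τ : ℂ)) * ψ τ) *
        (Complex.exp (-(2 * I * (τ : ℂ) * (r x' : ℂ))) * (x - x')⁻¹ * μ x') := fun x' => by
      simp only [hF]; ring
    simp_rw [this]
    rw [integral_const_mul, hv₁]
    ring
  have hright (x' : ℂ) : deriv ψhat (2 * r x') * (x - x')⁻¹ * μ x' = ∫ τ : ℝ, F τ x' := by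
    rw [funext hψhat, (ψ.hasDerivAt_integral_exp_neg_I_mul _).deriv, mul_assoc,
      ← integral_mul_const]
    refine integral_congr_ae (.of_forall fun τ => ?_)
    simp only [hF, hphase]
    ring
  refine ⟨fun τ => ?_, ?_, ?_, ?_⟩
  · simp_rw [mul_assoc _ (x - _)⁻¹]
    exact hg.bdd_mul (c := 1) (Continuous.aestronglyMeasurable (by fun_prop))
      (.of_forall (hnorm τ))
  · simp_rw [hleft]
    exact hFint.integral_prod_left.const_mul _
  · change IntegrableOn (fun x' => deriv ψhat (2 * r x') * (x - x')⁻¹ * μ x') _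
    simp_rw [hright]
    exact hFint.integral_prod_right
  · change _ = _ * ∫ x' in Metric.ball (0 : ℂ) 1,
      deriv ψhat (2 * r x') * (x - x')⁻¹ * μ x'
    simp_rw [hleft, hright]
    rw [integral_const_mul, integral_integral_swap hFint]
end

section
/- Let 0 < ρ < 1, let μ : ℂ → ℂ be bounded and measurable with μ(x′) = 0 for |x′| ≥ ρ, let φ ∈ ℝ, and define v₁(x, τ) = (−iτ e^{−iφ}/π) ∫_{|x′|<1} e^{−2iτ Re(e^{iφ}x′)} (x − x′)^{−1} μ(x′) dm(x′). Let ψ : ℝ → ℂ be a Schwartz function with ψ̂(t) = ∫_ℝ e^{−itτ} ψ(τ) dτ. Then the complex boundary average of the windowed single-scattering term over the positively oriented unit circle equals windowed Radon-transform data: (1/(2πi)) ∮_{|x|=1} (∫_ℝ ψ(τ) v₁(x, τ) dτ) dx = (e^{−iφ}/π) ∫_ℝ ψ̂′(2s) · Rμ(n_{−φ}, s) ds, where n_{−φ} = (cos φ, −sin φ) and Rμ(n, s) = ∫_ℝ μ(sn + r n⊥) dr is the two-dimensional Radon transform of μ (with n⊥ = (−n₂, n₁), identifying ℂ with ℝ²).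 -/
open Complex MeasureTheory

lemma SchwartzMap.integrable_neg_I_mul (ψ : SchwartzMap ℝ ℂ) :
    Integrable fun τ : ℝ => -(I * (τ : ℂ)) * ψ τ := by
  refine (ψ.integrable_pow_mul volume 1).mono'
    (Continuous.aestronglyMeasurable (by fun_prop)) (Filter.Eventually.of_forall ?_)
  intro τ
  simp

lemma norm_exp_neg_I_mul_mul (t τ : ℝ) : ‖exp (-(I * (t : ℂ) * (τ : ℂ)))‖ = 1 := by
  simp [Complex.norm_exp]

lemma SchwartzMap.hasDerivAt_integral_exp_mul (ψ : SchwartzMap ℝ ℂ) (t : ℝ) :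
    HasDerivAt (fun t : ℝ => ∫ τ : ℝ, exp (-(I * (t : ℂ) * (τ : ℂ))) * ψ τ)
      (∫ τ : ℝ, exp (-(I * (t : ℂ) * (τ : ℂ))) * (-(I * (τ : ℂ)) * ψ τ)) t := by
  refine (hasDerivAt_integral_of_dominated_loc_of_deriv_le
    (F := fun t τ : ℝ => exp (-(I * (t : ℂ) * (τ : ℂ))) * ψ τ)
    (F' := fun t τ : ℝ => exp (-(I * (t : ℂ) * (τ : ℂ))) * (-(I * (τ : ℂ)) * ψ τ))
    (bound := fun τ : ℝ => ‖-(I * (τ : ℂ)) * ψ τ‖) (s := Set.univ) Filter.univ_mem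
    (Filter.Eventually.of_forall fun t => ?_) ?_ ?_ ?_ ψ.integrable_neg_I_mul.norm ?_).2
  · exact Continuous.aestronglyMeasurable (by fun_prop)
  · refine (ψ.integrable (μ := volume)).norm.mono'
      (Continuous.aestronglyMeasurable (by fun_prop)) (Filter.Eventually.of_forall fun τ => ?_)
    rw [norm_mul, norm_exp_neg_I_mul_mul, one_mul]
  · exact Continuous.aestronglyMeasurable (by fun_prop)
  · refine Filter.Eventually.of_forall fun τ t _ => ?_
    rw [norm_mul, norm_exp_neg_I_mul_mul, one_mul]
  · refine Filter.Eventually.of_forall fun τ t _ => ?_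
    have h1 : HasDerivAt (fun t : ℝ => -(I * (t : ℂ) * (τ : ℂ))) (-(I * 1 * (τ : ℂ))) t :=
      ((((hasDerivAt_id t).ofReal_comp).const_mul I).mul_const (τ : ℂ)).neg
    refine (h1.cexp.mul_const (ψ τ)).congr_deriv ?_
    ring

lemma continuous_integral_exp_mul {f : ℝ → ℂ} (hf : Integrable f) :
    Continuous fun t : ℝ => ∫ τ : ℝ, exp (-(I * (t : ℂ) * (τ : ℂ))) * f τ := by
  refine continuous_of_dominated (bound := fun τ => ‖f τ‖) (fun t => ?_) (fun t => ?_) hf.norm ?_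
  · exact (Continuous.aestronglyMeasurable (by fun_prop)).mul hf.aestronglyMeasurable
  · refine Filter.Eventually.of_forall fun τ => ?_
    rw [norm_mul, norm_exp_neg_I_mul_mul, one_mul]
  · refine Filter.Eventually.of_forall fun τ => ?_
    fun_prop

lemma integral_mul_integral_exp_mul {α : Type*} [MeasurableSpace α] {ν : Measure α} [SFinite ν]
    {f : ℝ → ℂ} (hf : Integrable f) {k : α → ℂ} (hk : Integrable k ν) {a : α → ℝ}
    (ha : Measurable a) :
    ∫ τ : ℝ, f τ * ∫ x, exp (-(I * (a x : ℂ) * (τ : ℂ))) * k x ∂ν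
      = ∫ x, (∫ τ : ℝ, exp (-(I * (a x : ℂ) * (τ : ℂ))) * f τ) * k x ∂ν := by
  have hint : Integrable (Function.uncurry fun (τ : ℝ) (x : α) =>
      exp (-(I * (a x : ℂ) * (τ : ℂ))) * (f τ * k x)) (volume.prod ν) := by
    refine (hf.mul_prod hk).bdd_mul (c := 1) (Measurable.aestronglyMeasurable (by fun_prop)) ?_
    exact Filter.Eventually.of_forall fun p => (norm_exp_neg_I_mul_mul _ _).le
  calc _ = ∫ τ : ℝ, ∫ x, exp (-(I * (a x : ℂ) * (τ : ℂ))) * (f τ * k x) ∂ν := by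
        simp_rw [← integral_const_mul]
        congr! 4
        ring
    _ = ∫ x, (∫ τ : ℝ, exp (-(I * (a x : ℂ) * (τ : ℂ))) * (f τ * k x)) ∂ν :=
        integral_integral_swap hint
    _ = _ := by
        simp_rw [← integral_mul_const, mul_assoc]

lemma norm_inv_sub_mul_le {ρ : ℝ} (hρ1 : ρ < 1) {h : ℂ → ℂ}
    (hsupp : ∀ z : ℂ, ρ ≤ ‖z‖ → h z = 0) {x : ℂ} (hx : ‖x‖ = 1) (z : ℂ) :
    ‖(x - z)⁻¹ * h z‖ ≤ (1 - ρ)⁻¹ * ‖h z‖ := by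
  rcases le_or_gt ρ ‖z‖ with hz | hz
  · simp [hsupp z hz]
  · rw [norm_mul, norm_inv]
    have : 1 - ρ ≤ ‖x - z‖ := by
      have := norm_sub_norm_le x z
      linarith
    have : 0 < 1 - ρ := by linarith
    gcongr

lemma integrable_inv_sub_mul {ρ : ℝ} (hρ1 : ρ < 1) {h : ℂ → ℂ} (hh : Integrable h)
    (hsupp : ∀ z : ℂ, ρ ≤ ‖z‖ → h z = 0) {x : ℂ} (hx : ‖x‖ = 1) :
    Integrable fun z => (x - z)⁻¹ * h z :=
  (hh.norm.const_mul (1 - ρ)⁻¹).mono'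
    ((Measurable.aestronglyMeasurable (by fun_prop)).mul hh.aestronglyMeasurable)
    (Filter.Eventually.of_forall (norm_inv_sub_mul_le hρ1 hsupp hx))

lemma circleIntegral_integral_inv_sub_mul {ρ : ℝ} (hρ1 : ρ < 1) {h : ℂ → ℂ} (hh : Integrable h)
    (hsupp : ∀ z : ℂ, ρ ≤ ‖z‖ → h z = 0) :
    (∮ x in C(0, 1), ∫ z, (x - z)⁻¹ * h z) = 2 * (Real.pi : ℂ) * I * ∫ z, h z := by
  have hnorm (θ : ℝ) : ‖circleMap 0 1 θ‖ = 1 := by simp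
  have : IsFiniteMeasure (volume.restrict (Set.uIoc 0 (2 * Real.pi))) :=
    isFiniteMeasure_restrict.2 (by simp [Set.uIoc])
  have hint : Integrable (Function.uncurry fun (θ : ℝ) (z : ℂ) =>
      deriv (circleMap 0 1) θ * ((circleMap 0 1 θ - z)⁻¹ * h z))
      ((volume.restrict (Set.uIoc 0 (2 * Real.pi))).prod volume) := by
    have hb : Integrable (fun p : ℝ × ℂ => (1 - ρ)⁻¹ * ‖h p.2‖)
        ((volume.restrict (Set.uIoc 0 (2 * Real.pi))).prod volume) :=
      (hh.norm.comp_snd _).const_mul _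
    refine hb.mono' ?_ (Filter.Eventually.of_forall fun p => ?_)
    · have h1 : Measurable fun p : ℝ × ℂ => deriv (circleMap 0 1) p.1 := by
        simp only [deriv_circleMap]
        fun_prop
      have h2 : Measurable fun p : ℝ × ℂ => (circleMap 0 1 p.1 - p.2)⁻¹ := by fun_prop
      exact h1.aestronglyMeasurable.mul
        (h2.aestronglyMeasurable.mul hh.aestronglyMeasurable.comp_snd)
    · simp only [Function.uncurry]
      rw [norm_mul]
      simpa using norm_inv_sub_mul_le hρ1 hsupp (hnorm p.1) p.2
  calc _ = ∫ θ in (0 : ℝ)..2 * Real.pi, ∫ z,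
          deriv (circleMap 0 1) θ * ((circleMap 0 1 θ - z)⁻¹ * h z) := by
        simp_rw [circleIntegral, smul_eq_mul, integral_const_mul]
    _ = ∫ z, ∫ θ in (0 : ℝ)..2 * Real.pi,
          deriv (circleMap 0 1) θ * ((circleMap 0 1 θ - z)⁻¹ * h z) :=
        intervalIntegral_integral_swap hint
    _ = ∫ z, 2 * (Real.pi : ℂ) * I * h z := by
        refine integral_congr_ae (Filter.Eventually.of_forall fun z => ?_)
        rcases le_or_gt ρ ‖z‖ with hz | hz
        · simp [hsupp z hz]
        · have hz1 : z ∈ Metric.ball (0 : ℂ) 1 := by simpa using hz.trans hρ1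
          simp only [← mul_assoc, intervalIntegral.integral_mul_const]
          rw [← circleIntegral.integral_sub_inv_of_mem_ball hz1]
          simp [circleIntegral]
    _ = _ := integral_const_mul _ _

/-- Fubini in the rotated coordinates `e^{iφ} z = s + i r`. -/
lemma integral_eq_integral_integral_rotation (φ : ℝ) {F : ℂ → ℂ} (hF : Integrable F) :
    ∫ z, F z = ∫ s : ℝ, ∫ r : ℝ, F (((s * Real.cos φ + r * Real.sin φ : ℝ) : ℂ)
          + ((-(s * Real.sin φ) + r * Real.cos φ : ℝ) : ℂ) * I) := by
  have hmp : MeasurePreserving (rotation (Circle.exp (-φ))) :=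
    LinearIsometryEquiv.measurePreserving _
  have hmp' : MeasurePreserving
      (fun p : ℝ × ℝ => rotation (Circle.exp (-φ)) (measurableEquivRealProd.symm p)) :=
    hmp.comp (volume_preserving_equiv_real_prod.symm _)
  have hemb : MeasurableEmbedding
      (fun p : ℝ × ℝ => rotation (Circle.exp (-φ)) (measurableEquivRealProd.symm p)) :=
    (rotation (Circle.exp (-φ))).toHomeomorph.measurableEmbedding.comp
      measurableEquivRealProd.symm.measurableEmbedding
  have hcoord (s r : ℝ) : rotation (Circle.exp (-φ)) (measurableEquivRealProd.symm (s, r))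
      = ((s * Real.cos φ + r * Real.sin φ : ℝ) : ℂ)
          + ((-(s * Real.sin φ) + r * Real.cos φ : ℝ) : ℂ) * I := by
    rw [rotation_apply, Circle.coe_exp, exp_mul_I, ← ofReal_cos, ← ofReal_sin]
    apply Complex.ext <;> simp <;> ring
  rw [← hmp'.integral_comp hemb F, Measure.volume_eq_prod, integral_prod]
  · simp_rw [hcoord]
  · exact (hmp'.integrable_comp_emb hemb).2 hF

theorem boundary_average_of_windowed_single_scattering_is_radon_data
    (ρ : ℝ) (hρ : 0 < ρ) (hρ1 : ρ < 1)
    (μ : ℂ → ℂ) (hμmeas : Measurable μ) (hμbdd : ∃ C : ℝ, ∀ z : ℂ, ‖μ z‖ ≤ C)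
    (hμsupp : ∀ z : ℂ, ρ ≤ ‖z‖ → μ z = 0)
    (φ : ℝ) (ψ : SchwartzMap ℝ ℂ)
    (ψhat : ℝ → ℂ)
    (hψhat : ∀ t : ℝ, ψhat t = ∫ τ : ℝ, Complex.exp (-(I * (t : ℂ) * (τ : ℂ))) * ψ τ)
    (v₁ : ℂ → ℝ → ℂ)
    (hv₁ : ∀ (x : ℂ) (τ : ℝ), v₁ x τ =
      (-(I * (τ : ℂ) * Complex.exp (-(I * (φ : ℂ)))) / (Real.pi : ℂ)) *
        ∫ x' in Metric.ball (0 : ℂ) 1,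
          Complex.exp (-(2 * I * (τ : ℂ) * (((Complex.exp (I * (φ : ℂ)) * x').re : ℝ) : ℂ)))
            * (x - x')⁻¹ * μ x')
    (Rμ : ℝ → ℂ)
    (hRμ : ∀ s : ℝ, Rμ s = ∫ r : ℝ,
      μ (((s * Real.cos φ + r * Real.sin φ : ℝ) : ℂ)
          + ((-(s * Real.sin φ) + r * Real.cos φ : ℝ) : ℂ) * I)) :
    (1 / (2 * (Real.pi : ℂ) * I)) *
        (∮ x in C(0, 1), (∫ τ : ℝ, ψ τ * v₁ x τ))
      = (Complex.exp (-(I * (φ : ℂ))) / (Real.pi : ℂ)) *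
          ∫ s : ℝ, deriv ψhat (2 * s) * Rμ s := by
  obtain ⟨C, hC⟩ := hμbdd
  have hψ : ψhat = fun t : ℝ => ∫ τ : ℝ, exp (-(I * (t : ℂ) * (τ : ℂ))) * ψ τ := funext hψhat
  have hD (t : ℝ) : deriv ψhat t
      = ∫ τ : ℝ, exp (-(I * (t : ℂ) * (τ : ℂ))) * (-(I * (τ : ℂ)) * ψ τ) := by
    rw [hψ]
    exact (ψ.hasDerivAt_integral_exp_mul t).deriv
  have hDcont : Continuous (deriv ψhat) := by
    rw [funext hD]
    exact continuous_integral_exp_mul ψ.integrable_neg_I_mul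
  have hball (z : ℂ) (hz : z ∉ Metric.ball (0 : ℂ) 1) : μ z = 0 :=
    hμsupp z (hρ1.le.trans (by simpa using hz))
  have hμint : Integrable μ := by
    refine (integrableOn_iff_integrable_of_support_subset (s := Metric.ball (0 : ℂ) 1)
      fun z hz => by_contra fun h => hz (hball z h)).1 ?_
    exact Measure.integrableOn_of_bounded measure_ball_lt_top.ne hμmeas.aestronglyMeasurable
      (Filter.Eventually.of_forall hC)
  set a : ℂ → ℝ := fun z => 2 * (exp (I * (φ : ℂ)) * z).re with ha
  have hacont : Continuous a := by fun_prop
  set h : ℂ → ℂ := fun z => deriv ψhat (a z) * μ z with hh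
  have hhint : Integrable h := by
    obtain ⟨K, hK⟩ := (isCompact_closedBall (0 : ℂ) 1).exists_bound_of_continuousOn
      (hDcont.comp hacont).continuousOn
    refine (hμint.norm.const_mul K).mono'
      ((hDcont.comp hacont).aestronglyMeasurable.mul hμint.aestronglyMeasurable)
      (Filter.Eventually.of_forall fun z => ?_)
    by_cases hz : z ∈ Metric.ball (0 : ℂ) 1
    · rw [hh, norm_mul]
      gcongr
      exact hK z (Metric.ball_subset_closedBall hz)
    · simp [hh, hball z hz]
  have hhsupp (z : ℂ) (hz : ρ ≤ ‖z‖) : h z = 0 := by simp [hh, hμsupp z hz]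
  have hwindow (x : ℂ) (hx : ‖x‖ = 1) : ∫ τ : ℝ, ψ τ * v₁ x τ
      = exp (-(I * (φ : ℂ))) / (Real.pi : ℂ) * ∫ z, (x - z)⁻¹ * h z := by
    calc _ = ∫ τ : ℝ, exp (-(I * (φ : ℂ))) / (Real.pi : ℂ) * ((-(I * (τ : ℂ)) * ψ τ) *
            ∫ z, exp (-(I * (a z : ℂ) * (τ : ℂ))) * ((x - z)⁻¹ * μ z)) := by
          refine integral_congr_ae (Filter.Eventually.of_forall fun τ => ?_)
          simp only
          rw [hv₁, setIntegral_eq_integral_of_forall_compl_eq_zero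
            fun z hz => by rw [hball z hz, mul_zero]]
          have : ∀ z, exp (-(2 * I * (τ : ℂ) * (((exp (I * (φ : ℂ)) * z).re : ℝ) : ℂ)))
              * (x - z)⁻¹ * μ z = exp (-(I * (a z : ℂ) * (τ : ℂ))) * ((x - z)⁻¹ * μ z) := by
            intro z
            rw [mul_assoc, ha]
            congr 3
            push_cast
            ring
          simp_rw [this]
          ring
      _ = _ := by
          rw [integral_const_mul, integral_mul_integral_exp_mul ψ.integrable_neg_I_mul
            (integrable_inv_sub_mul hρ1 hμint hμsupp hx) hacont.measurable]
          simp_rw [hh, hD]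
          congr! 3
          ring
  have hcircle : (∮ x in C(0, 1), (∫ τ : ℝ, ψ τ * v₁ x τ))
      = exp (-(I * (φ : ℂ))) / (Real.pi : ℂ) * (2 * (Real.pi : ℂ) * I * ∫ z, h z) := by
    rw [← circleIntegral_integral_inv_sub_mul hρ1 hhint hhsupp, ← circleIntegral.integral_const_mul]
    exact circleIntegral.integral_congr zero_le_one fun x hx => hwindow x (by simpa using hx)
  have hradon : ∫ z, h z = ∫ s : ℝ, deriv ψhat (2 * s) * Rμ s := by
    rw [integral_eq_integral_integral_rotation φ hhint]
    refine integral_congr_ae (Filter.Eventually.of_forall fun s => ?_)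
    simp only
    rw [hRμ, ← integral_const_mul]
    refine integral_congr_ae (Filter.Eventually.of_forall fun r => ?_)
    simp only [hh]
    congr 2
    have key := Real.sin_sq_add_cos_sq φ
    simp only [ha, mul_comm I, exp_mul_I, ← ofReal_cos, ← ofReal_sin]
    simp [-ofReal_cos, -ofReal_sin]
    linear_combination s * key
  rw [hcircle, hradon]
  have hpi : (Real.pi : ℂ) ≠ 0 := ofReal_ne_zero.2 Real.pi_ne_zero
  field_simp
end
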